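/- For all natural numbers m, n and every complex number d with Re(d) > 0, there holds ₃F₂(1 + 2m, 1 + 2n, d+1; m + n + 5/2, d; 1/2) = (2π (3/2)_{m+n+1}) / ((2m − 2n + 1)(2m − 2n − 1)) · [ ((m + n + 1/2) − (2m+1)(2n+1)/d) / (m! n!) + ((2m + 2n + 3)/d − 2) / (π (1/2)_m (1/2)_n) ]. -/

import Mathlib

open scoped Nat

/-- Pochhammer symbol `(x)_k = x (x+1) ⋯ (x+k-1)` for a complex number `x`. -/
noncomputable def poch (x : ℂ) (k : ℕ) : ℂ := (ascPochhammer ℂ k).eval x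

/-- The generalized hypergeometric series
`ₚF_q(a₁,…,aₚ; b₁,…,b_q; z) = ∑ₖ ((a₁)ₖ ⋯ (aₚ)ₖ)/((b₁)ₖ ⋯ (b_q)ₖ) · zᵏ/k!`. -/
noncomputable def hyp (a b : List ℂ) (z : ℂ) : ℂ :=
  ∑' k : ℕ, ((a.map (poch · k)).prod / (b.map (poch · k)).prod) * z ^ k / (k ! : ℂ)

open Filter Topology

lemma HasSum.congr_terms {f g : ℕ → ℂ} {s : ℂ} (hf : HasSum f s) (h : ∀ k, g k = f k) :
    HasSum g s :=
  (funext h : g = f) ▸ hf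

lemma poch_zero (x : ℂ) : poch x 0 = 1 := by simp [poch]

lemma poch_succ (x : ℂ) (k : ℕ) : poch x (k + 1) = poch x k * (x + k) :=
  ascPochhammer_succ_eval k x

lemma mul_poch_add_one (x : ℂ) (k : ℕ) : x * poch (x + 1) k = poch x k * (x + k) := by
  induction k with
  | zero => simp [poch_zero]
  | succ k ih =>
    rw [poch_succ, poch_succ, ← mul_assoc, ih]
    push_cast
    ring

lemma poch_ne_zero {x : ℂ} (hx : ∀ k : ℕ, x + k ≠ 0) (k : ℕ) : poch x k ≠ 0 := by
  induction k with
  | zero => simp [poch_zero]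
  | succ k ih =>
    rw [poch_succ]
    exact mul_ne_zero ih (hx k)

lemma natCast_shift_ne_zero {x : ℂ} (hx : 0 < x.re) (k : ℕ) : x + k ≠ 0 := by
  intro h
  have := congrArg Complex.re h
  simp at this
  have : (0 : ℝ) ≤ k := k.cast_nonneg
  linarith

/-- The `k`-th term of the Gauss series `₂F₁(a, b; c; 1/2)`. -/
noncomputable def gaussTerm (a b c : ℂ) (k : ℕ) : ℂ :=
  poch a k * poch b k / poch c k * (1 / 2) ^ k / (k ! : ℂ)

lemma gaussTerm_zero (a b c : ℂ) : gaussTerm a b c 0 = 1 := by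
  simp [gaussTerm, poch_zero]

lemma gaussTerm_comm (a b c : ℂ) : gaussTerm a b c = gaussTerm b a c := by
  funext k
  simp only [gaussTerm, mul_comm (poch a k)]

section

variable {a b c : ℂ}

lemma gaussTerm_succ (hc : ∀ k : ℕ, c + k ≠ 0) (k : ℕ) :
    gaussTerm a b c (k + 1) =
      gaussTerm a b c k * ((a + k) * (b + k) / (2 * (c + k) * (k + 1))) := by
  have h1 := poch_ne_zero hc k
  have h2 := hc k
  have h3 : (k ! : ℂ) ≠ 0 := by exact_mod_cast k.factorial_ne_zero
  have h4 : (k + 1 : ℂ) ≠ 0 := by exact_mod_cast k.succ_ne_zero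
  simp only [gaussTerm, poch_succ, Nat.factorial_succ, pow_succ]
  push_cast
  field_simp

lemma summable_pow_mul_gaussTerm (hc : ∀ k : ℕ, c + k ≠ 0) (j : ℕ) :
    Summable fun k : ℕ => (k : ℂ) ^ j * gaussTerm a b c k := by
  have h0 (x : ℂ) : Tendsto (fun k : ℕ => 1 + x / k) atTop (𝓝 1) := by
    simpa using (tendsto_const_div_atTop_nhds_zero_nat x).const_add 1
  have hlim : Tendsto (fun k : ℕ => (1 + 1 / (k : ℂ)) ^ j * ((1 + a / k) * (1 + b / k) /
      (2 * (1 + c / k) * (1 + 1 / k)))) atTop (𝓝 (1 ^ j * (1 * 1 / (2 * 1 * 1)))) :=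
    ((h0 1).pow j).mul (((h0 a).mul (h0 b)).div (((h0 c).const_mul 2).mul (h0 1)) (by norm_num))
  have hnorm := hlim.norm
  have hlt : ‖(1 : ℂ) ^ j * (1 * 1 / (2 * 1 * 1))‖ < 3 / 4 := by norm_num
  refine summable_of_ratio_norm_eventually_le (r := 3 / 4) (by norm_num) ?_
  filter_upwards [hnorm.eventually_lt_const hlt, eventually_gt_atTop 0] with k hk hk0
  have hk1 : (k : ℂ) ≠ 0 := by exact_mod_cast hk0.ne'
  have h2 := hc k
  have h4 : (k + 1 : ℂ) ≠ 0 := by exact_mod_cast k.succ_ne_zero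
  have key : ((k + 1 : ℕ) : ℂ) ^ j * gaussTerm a b c (k + 1) =
      ((1 + 1 / (k : ℂ)) ^ j * ((1 + a / k) * (1 + b / k) /
      (2 * (1 + c / k) * (1 + 1 / k)))) * ((k : ℂ) ^ j * gaussTerm a b c k) := by
    have e1 : ((k + 1 : ℕ) : ℂ) ^ j = (1 + 1 / (k : ℂ)) ^ j * (k : ℂ) ^ j := by
      rw [← mul_pow]
      congr 1
      push_cast
      field_simp
    have e2 : (1 + a / k) * (1 + b / k) / (2 * (1 + c / k) * (1 + 1 / (k : ℂ))) =
        (a + k) * (b + k) / (2 * (c + k) * (k + 1)) := by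
      have : (1 + c / k) = (c + k) / k := by field_simp; ring
      rw [this]
      have : (1 + 1 / (k : ℂ)) = (k + 1) / k := by field_simp
      rw [this]
      field_simp
      ring
    rw [e1, e2, gaussTerm_succ hc]
    ring
  rw [key, norm_mul]
  exact mul_le_mul_of_nonneg_right hk.le (norm_nonneg _)

lemma hasSum_telescope {G : ℕ → ℂ} (hG : Summable G) :
    HasSum (fun k => G (k + 1) - G k) (-G 0) := by
  have h := ((hasSum_nat_add_iff' 1).mpr hG.hasSum).sub hG.hasSum
  simpa using h

/-- Telescoping with the antidifference `(x + y k) k tₖ`, where `tₖ` is the Gauss term. -/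
lemma hasSum_gaussTerm_telescope (hc : ∀ k : ℕ, c + k ≠ 0) (x y : ℂ) :
    HasSum (fun k : ℕ => ((x + y * (k + 1)) * ((a + k) * (b + k) / 2) -
      (x + y * k) * (k * (c + k))) * (gaussTerm a b c k / (c + k))) 0 := by
  have hG : Summable fun k : ℕ => (x + y * k) * k * gaussTerm a b c k := by
    refine (((summable_pow_mul_gaussTerm (a := a) (b := b) hc 1).mul_left x).add
      ((summable_pow_mul_gaussTerm (a := a) (b := b) hc 2).mul_left y)).congr fun k => ?_
    ring
  have h := hasSum_telescope hG
  simp only [Nat.cast_zero, mul_zero, zero_mul, neg_zero] at h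
  refine h.congr_terms fun k => ?_
  have h2 := hc k
  have h4 : (k + 1 : ℂ) ≠ 0 := by exact_mod_cast k.succ_ne_zero
  rw [gaussTerm_succ hc]
  push_cast
  field_simp

lemma gaussTerm_add_two (ha : a ≠ 0) (ha' : a + 1 ≠ 0) (hc : ∀ k : ℕ, c + k ≠ 0) (k : ℕ) :
    gaussTerm (a + 2) b (c + 1) k =
      c / (a * (a + 1)) * ((a + k) * (a + k + 1)) * (gaussTerm a b c k / (c + k)) := by
  have hc0 : c ≠ 0 := by simpa using hc 0
  have hck := hc k
  have h1 : poch (a + 2) k = poch a k * ((a + k) * (a + k + 1)) / (a * (a + 1)) := by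
    have e1 := mul_poch_add_one a k
    have e2 := mul_poch_add_one (a + 1) k
    rw [show a + 1 + 1 = a + 2 by ring] at e2
    rw [eq_div_iff (mul_ne_zero ha ha')]
    linear_combination a * e2 + (a + 1 + k) * e1
  have h2 : poch (c + 1) k = poch c k * (c + k) / c := by
    rw [eq_div_iff hc0, ← mul_poch_add_one]
    ring
  have h3 := poch_ne_zero hc k
  simp only [gaussTerm, h1, h2]
  field_simp

lemma hasSum_gaussTerm_add_two {A B q : ℂ} (ha : a ≠ 0) (ha' : a + 1 ≠ 0)
    (hac : c - a - 3 ≠ 0) (hc : ∀ k : ℕ, c + k ≠ 0) (habc : a + b + 3 = 2 * c)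
    (hq : q = 2 * c / (a * (a + 1)) * ((a - c + 1) / (c - a - 3)))
    (hA : HasSum (gaussTerm a b c) A) (hB : HasSum (fun k : ℕ => k * gaussTerm a b c k) B) :
    HasSum (gaussTerm (a + 2) b (c + 1))
      ((1 - q * (a * b) / (2 * c)) * A + (c / (a * (a + 1)) + q / 2) * B) := by
  have hc0 : c ≠ 0 := by simpa using hc 0
  have h := ((hA.mul_left (1 - q * (a * b) / (2 * c))).add
    (hB.mul_left (c / (a * (a + 1)) + q / 2))).add
    (hasSum_gaussTerm_telescope hc q 0 (a := a) (b := b))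
  rw [add_zero] at h
  refine h.congr_terms fun k => ?_
  rw [gaussTerm_add_two ha ha' hc]
  have hk := hc k
  obtain ⟨s, hs⟩ : ∃ s, gaussTerm a b c k = s * (c + k) := ⟨_, (div_mul_cancel₀ _ hk).symm⟩
  rw [hs, mul_div_cancel_right₀ _ hk, hq]
  obtain rfl : b = 2 * c - a - 3 := by linear_combination habc
  field_simp
  ring

lemma hasSum_mul_gaussTerm_add_two {A B q : ℂ} (ha : a ≠ 0) (ha' : a + 1 ≠ 0)
    (hac : c - a - 3 ≠ 0) (hc : ∀ k : ℕ, c + k ≠ 0) (habc : a + b + 3 = 2 * c)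
    (hq : q = 2 * c / (a * (a + 1)) * ((a - c + 1) / (c - a - 3)))
    (hA : HasSum (gaussTerm a b c) A) (hB : HasSum (fun k : ℕ => k * gaussTerm a b c k) B) :
    HasSum (fun k : ℕ => k * gaussTerm (a + 2) b (c + 1) k)
      ((q / 2 + c / (a * (a + 1))) * (a * b) * A +
        (c / (a * (a + 1)) * (2 * a - c) - q * c / 2) * B) := by
  have hc0 : c ≠ 0 := by simpa using hc 0
  have h := ((hA.mul_left ((q / 2 + c / (a * (a + 1))) * (a * b))).add
    (hB.mul_left (c / (a * (a + 1)) * (2 * a - c) - q * c / 2))).add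
    (hasSum_gaussTerm_telescope hc (-c * q + 2 * c / (a * (a + 1)) * (1 - c))
      (-2 * c / (a * (a + 1))) (a := a) (b := b))
  rw [add_zero] at h
  refine h.congr_terms fun k => ?_
  rw [gaussTerm_add_two ha ha' hc]
  have hk := hc k
  obtain ⟨s, hs⟩ : ∃ s, gaussTerm a b c k = s * (c + k) := ⟨_, (div_mul_cancel₀ _ hk).symm⟩
  rw [hs, mul_div_cancel_right₀ _ hk, hq]
  obtain rfl : b = 2 * c - a - 3 := by linear_combination habc
  field_simp
  ring

end

lemma hasSum_factorial_div_poch :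
    HasSum (fun k : ℕ => (k ! : ℂ) / poch (3 / 2) k * (1 / 2) ^ k) (Real.pi / 2 : ℂ) := by
  have hden (x : ℝ) : 1 + Real.cos x ^ 2 ≠ 0 := by positivity
  have hint : ∫ x in (0 : ℝ)..Real.pi, Real.sin x * (1 - Real.sin x ^ 2 / 2)⁻¹ = Real.pi := by
    have hd (x : ℝ) : HasDerivAt (fun x => -2 * Real.arctan (Real.cos x))
        (Real.sin x * (1 - Real.sin x ^ 2 / 2)⁻¹) x := by
      convert! ((Real.hasDerivAt_cos x).arctan).const_mul (-2) using 1
      have h1 : 1 - Real.sin x ^ 2 / 2 = (1 + Real.cos x ^ 2) / 2 := by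
        rw [Real.sin_sq]; ring
      rw [h1]
      have := hden x
      field_simp
    rw [intervalIntegral.integral_eq_sub_of_hasDerivAt (fun x _ => hd x)]
    · simp [Real.arctan_neg]
      ring
    · apply Continuous.intervalIntegrable
      refine Real.continuous_sin.mul (Continuous.inv₀ (by fun_prop) fun x => ?_)
      nlinarith [Real.sin_sq_le_one x]
  have hsum : HasSum (fun k : ℕ => ∫ x in (0 : ℝ)..Real.pi, Real.sin x * (Real.sin x ^ 2 / 2) ^ k)
      (∫ x in (0 : ℝ)..Real.pi, Real.sin x * (1 - Real.sin x ^ 2 / 2)⁻¹) := by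
    refine intervalIntegral.hasSum_integral_of_dominated_convergence
      (fun k _ => (1 / 2 : ℝ) ^ k) (fun k => ?_) (fun k => ?_) ?_ ?_ ?_
    · exact Continuous.aestronglyMeasurable (by fun_prop)
    · refine Eventually.of_forall fun x _ => ?_
      rw [norm_mul, norm_pow]
      have h1 : ‖Real.sin x‖ ≤ 1 := Real.abs_sin_le_one x
      have h2 : ‖Real.sin x ^ 2 / 2‖ ≤ 1 / 2 := by
        rw [Real.norm_of_nonneg (by positivity)]
        linarith [Real.sin_sq_le_one x]
      calc _ ≤ 1 * (1 / 2 : ℝ) ^ k := by gcongr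
        _ = _ := one_mul _
    · exact Eventually.of_forall fun x _ => summable_geometric_of_lt_one (by norm_num) (by norm_num)
    · exact intervalIntegrable_const
    · refine Eventually.of_forall fun x _ => HasSum.mul_left _ (hasSum_geometric_of_lt_one
        (by positivity) ?_)
      linarith [Real.sin_sq_le_one x]
  rw [hint] at hsum
  have hc := (Complex.hasSum_ofReal.mpr hsum).div_const 2
  refine hc.congr_terms fun k => ?_
  have hk : ∀ k : ℕ, (k ! : ℂ) / poch (3 / 2) k =
      ((∏ i ∈ Finset.range k, (2 * (i : ℝ) + 2) / (2 * i + 3) : ℝ) : ℂ) := by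
    intro k
    induction k with
    | zero => simp [poch_zero]
    | succ k ih =>
      rw [Finset.prod_range_succ, Complex.ofReal_mul, ← ih, poch_succ, Nat.factorial_succ]
      have h1 := poch_ne_zero (natCast_shift_ne_zero (x := 3 / 2) (by norm_num)) k
      have h2 := natCast_shift_ne_zero (x := 3 / 2) (by norm_num) k
      have h3 : (2 * k + 3 : ℂ) ≠ 0 := by
        contrapose! h2
        linear_combination h2 / 2
      push_cast
      field_simp
      ring
  have h : ∫ x in (0 : ℝ)..Real.pi, Real.sin x * (Real.sin x ^ 2 / 2) ^ k =
      (1 / 2) ^ k * (2 * ∏ i ∈ Finset.range k, (2 * (i : ℝ) + 2) / (2 * i + 3)) := by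
    rw [← integral_sin_pow_odd, ← intervalIntegral.integral_const_mul]
    congr 1
    funext x
    ring
  rw [h, hk]
  push_cast
  ring

/-- The sum of `₂F₁(2m+1, 2n+1; m+n+5/2; 1/2)`. -/
noncomputable def gaussSeriesSum (m n : ℕ) : ℂ :=
  2 * (Real.pi : ℂ) * poch (3/2) (m + n + 1) /
    ((2 * (m : ℂ) - 2 * (n : ℂ) + 1) * (2 * (m : ℂ) - 2 * (n : ℂ) - 1)) *
    (((m : ℂ) + (n : ℂ) + 1/2) / ((m ! : ℂ) * (n ! : ℂ)) -
      2 / ((Real.pi : ℂ) * poch (1/2) m * poch (1/2) n))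

/-- The sum of the Gauss series `₂F₁(2m+1, 2n+1; m+n+5/2; 1/2)` with `k`-th term weighted
by `k`. -/
noncomputable def gaussSeriesSumWeighted (m n : ℕ) : ℂ :=
  2 * (Real.pi : ℂ) * poch (3/2) (m + n + 1) /
    ((2 * (m : ℂ) - 2 * (n : ℂ) + 1) * (2 * (m : ℂ) - 2 * (n : ℂ) - 1)) *
    (-((2 * (m : ℂ) + 1) * (2 * (n : ℂ) + 1)) / ((m ! : ℂ) * (n ! : ℂ)) +
      (2 * (m : ℂ) + 2 * (n : ℂ) + 3) / ((Real.pi : ℂ) * poch (1/2) m * poch (1/2) n))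

lemma gaussSeriesSum_comm (m n : ℕ) : gaussSeriesSum m n = gaussSeriesSum n m := by
  simp only [gaussSeriesSum, add_comm n m]
  ring

lemma gaussSeriesSumWeighted_comm (m n : ℕ) : gaussSeriesSumWeighted m n = gaussSeriesSumWeighted n m := by
  simp only [gaussSeriesSumWeighted, add_comm n m]
  ring

/-- The closed forms for the Gauss series and its weighted variant both hold. -/
def HasGaussSums (m n : ℕ) : Prop :=
  HasSum (gaussTerm (1 + 2 * m) (1 + 2 * n) (m + n + 5/2)) (gaussSeriesSum m n) ∧
  HasSum (fun k : ℕ => k * gaussTerm (1 + 2 * m) (1 + 2 * n) (m + n + 5/2) k)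
    (gaussSeriesSumWeighted m n)

lemma HasGaussSums.symm {m n : ℕ} (h : HasGaussSums m n) : HasGaussSums n m := by
  unfold HasGaussSums
  rw [gaussTerm_comm, gaussSeriesSum_comm, gaussSeriesSumWeighted_comm, add_comm (n : ℂ) m]
  exact h

lemma lower_param_add_ne_zero (m n k : ℕ) : ((m : ℂ) + n + 5/2) + k ≠ 0 :=
  natCast_shift_ne_zero (by simp; positivity) k

lemma hasGaussSums_zero : HasGaussSums 0 0 := by
  have hc : ∀ k : ℕ, (5/2 : ℂ) + k ≠ 0 := natCast_shift_ne_zero (by norm_num)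
  have hterm (k : ℕ) : (5/2 + k - 1) * gaussTerm 1 1 (5/2) k =
      3 / 2 * ((k ! : ℂ) / poch (3 / 2) k * (1 / 2) ^ k) := by
    have h1 : poch 1 k = k ! := by simp [poch, ascPochhammer_eval_one]
    have h2 := mul_poch_add_one (3 / 2) k
    rw [show (3 / 2 + 1 : ℂ) = 5 / 2 by norm_num] at h2
    have h3 := poch_ne_zero hc k
    have h4 := poch_ne_zero (natCast_shift_ne_zero (x := 3 / 2) (by norm_num)) k
    have h5 : (k ! : ℂ) ≠ 0 := by exact_mod_cast k.factorial_ne_zero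
    simp only [gaussTerm, h1]
    field_simp
    linear_combination -2 * h2
  have hG : HasSum (fun k : ℕ => (5/2 + k - 1) * gaussTerm 1 1 (5/2) k)
      (3 / 2 * (Real.pi / 2 : ℂ)) :=
    (hasSum_factorial_div_poch.mul_left _).congr_terms hterm
  have hT : HasSum (fun k : ℕ => (k / 2 + 1) * gaussTerm 1 1 (5/2) k) (3 / 2) := by
    have := (hasSum_telescope hG.summable).neg
    norm_num [gaussTerm_zero] at this
    refine this.congr_terms fun k => ?_
    have h2 := hc k
    have h4 : (k + 1 : ℂ) ≠ 0 := by exact_mod_cast k.succ_ne_zero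
    rw [gaussTerm_succ hc]
    have e : (5/2 + (k + 1) - 1 : ℂ) * ((1 + k) * (1 + k) / (2 * (5/2 + k) * (k + 1))) =
        (k + 1) / 2 := by
      rw [mul_div_assoc', div_eq_iff (mul_ne_zero (mul_ne_zero two_ne_zero h2) h4)]
      ring
    linear_combination gaussTerm 1 1 (5/2) k * e
  have hpi : (Real.pi : ℂ) ≠ 0 := by exact_mod_cast Real.pi_ne_zero
  constructor
  · convert! (hT.mul_left 4).sub (hG.mul_left 2) using 1
    · funext k
      norm_num
      ring
    · norm_num [gaussSeriesSum, poch_zero, poch_succ]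
      field_simp
      ring
  · convert! (hG.mul_left 4).sub (hT.mul_left 6) using 1
    · funext k
      norm_num
      ring
    · norm_num [gaussSeriesSumWeighted, poch_zero, poch_succ]
      field_simp
      ring

lemma HasGaussSums.succ_left {m n : ℕ} (h : HasGaussSums m n) : HasGaussSums (m + 1) n := by
  have hc := lower_param_add_ne_zero m n
  have hc0 : (m : ℂ) + n + 5/2 ≠ 0 := by simpa using hc 0
  have ha : (1 + 2 * m : ℂ) ≠ 0 := by norm_cast; omega
  have ha' : (1 + 2 * m + 1 : ℂ) ≠ 0 := by norm_cast
  have hm : (m + 1 : ℂ) ≠ 0 := by norm_cast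
  have odd_ne (z : ℤ) (hz : z % 2 = 1) : (z : ℂ) ≠ 0 := by
    norm_cast
    omega
  have h1 : (2 * (m : ℂ) - 2 * n + 1) ≠ 0 := by
    have := odd_ne (2 * m - 2 * n + 1) (by omega)
    push_cast at this; exact this
  have h2 : (2 * (m : ℂ) - 2 * n - 1) ≠ 0 := by
    have := odd_ne (2 * m - 2 * n - 1) (by omega)
    push_cast at this; exact this
  have h3 : (2 * (m : ℂ) - 2 * n + 3) ≠ 0 := by
    have := odd_ne (2 * m - 2 * n + 3) (by omega)
    push_cast at this; exact this
  have hpi : (Real.pi : ℂ) ≠ 0 := by exact_mod_cast Real.pi_ne_zero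
  have hp1 := poch_ne_zero (natCast_shift_ne_zero (x := 1 / 2) (by norm_num)) m
  have hp2 := poch_ne_zero (natCast_shift_ne_zero (x := 1 / 2) (by norm_num)) n
  have hf1 : (m ! : ℂ) ≠ 0 := by exact_mod_cast m.factorial_ne_zero
  have hf2 : (n ! : ℂ) ≠ 0 := by exact_mod_cast n.factorial_ne_zero
  have hac : (m + n + 5/2 : ℂ) - (1 + 2 * m) - 3 ≠ 0 := by
    contrapose! h3
    linear_combination -2 * h3
  have habc : (1 + 2 * m : ℂ) + (1 + 2 * n) + 3 = 2 * (m + n + 5/2) := by ring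
  have e1 : (1 + 2 * (m + 1 : ℕ) : ℂ) = 1 + 2 * m + 2 := by push_cast; ring
  have e2 : ((m + 1 : ℕ) + n + 5/2 : ℂ) = m + n + 5/2 + 1 := by push_cast; ring
  have e3 : poch (3/2) (m + 1 + n + 1) = poch (3/2) (m + n + 1) * (m + n + 5/2) := by
    rw [show m + 1 + n + 1 = m + n + 1 + 1 by ring, poch_succ]
    push_cast
    ring
  have hQ : (2 * (m : ℂ) + 2 * n + 5) ≠ 0 := by
    contrapose! hc0
    linear_combination hc0 / 2
  have hC : (m + n + 5/2 : ℂ) = (2 * (m + n) + 5) / 2 := by ring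
  have hD : (m + n + 5/2 : ℂ) - (1 + 2 * m) - 3 = -(2 * (m - n) + 3) / 2 := by ring
  have hE : (1 / 2 + m : ℂ) = (1 + 2 * m) / 2 := by ring
  have hF : (1 + 2 * m + 1 : ℂ) = 2 * (m + 1) := by ring
  have h5 : 2 * (m + 1 : ℂ) - 2 * n - 1 = 2 * (m - n) + 1 := by ring
  have h6 : 2 * (m + 1 : ℂ) - 2 * n + 1 = 2 * (m - n) + 3 := by ring
  rw [← mul_sub] at h1 h2 h3
  rw [← mul_add] at hQ
  unfold HasGaussSums
  rw [e1, e2]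
  constructor
  · convert! hasSum_gaussTerm_add_two ha ha' hac hc habc rfl h.1 h.2 using 1
    simp only [gaussSeriesSum, gaussSeriesSumWeighted, e3]
    generalize poch (3/2) (m + n + 1) = P
    simp only [poch_succ, Nat.factorial_succ]
    generalize poch (1/2) m = p at *
    generalize poch (1/2) n = p' at *
    push_cast
    rw [h5, h6, hD, hC, hE, hF, ← mul_sub]
    field_simp
    ring
  · convert! hasSum_mul_gaussTerm_add_two ha ha' hac hc habc rfl h.1 h.2 using 1
    simp only [gaussSeriesSum, gaussSeriesSumWeighted, e3]
    generalize poch (3/2) (m + n + 1) = P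
    simp only [poch_succ, Nat.factorial_succ]
    generalize poch (1/2) m = p at *
    generalize poch (1/2) n = p' at *
    push_cast
    rw [h5, h6, hD, hC, hE, hF, ← mul_sub]
    field_simp
    ring

lemma hasGaussSums (m n : ℕ) : HasGaussSums m n := by
  induction m with
  | zero =>
    induction n with
    | zero => exact hasGaussSums_zero
    | succ n ih => exact ih.symm.succ_left.symm
  | succ m ih => exact ih.succ_left

theorem extended_gauss_second_formula (m n : ℕ) (d : ℂ) (hd : 0 < d.re) :
    hyp [1 + 2 * (m : ℂ), 1 + 2 * (n : ℂ), d + 1] [(m : ℂ) + (n : ℂ) + 5/2, d] (1/2) =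
      2 * (Real.pi : ℂ) * poch (3/2) (m + n + 1) /
        ((2 * (m : ℂ) - 2 * (n : ℂ) + 1) * (2 * (m : ℂ) - 2 * (n : ℂ) - 1)) *
        ((((m : ℂ) + (n : ℂ) + 1/2) - (2 * (m : ℂ) + 1) * (2 * (n : ℂ) + 1) / d) /
            ((m ! : ℂ) * (n ! : ℂ)) +
          ((2 * (m : ℂ) + 2 * (n : ℂ) + 3) / d - 2) /
            ((Real.pi : ℂ) * poch (1/2) m * poch (1/2) n)) := by
  have hd0 : d ≠ 0 := by
    rintro rfl
    simp at hd
  obtain ⟨h1, h2⟩ := hasGaussSums m n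
  have h := h1.add (h2.mul_left (1 / d))
  have hterm (k : ℕ) : poch (d + 1) k = poch d k * (d + k) / d := by
    rw [eq_div_iff hd0, ← mul_poch_add_one]
    ring
  have hsum : HasSum (fun k : ℕ => (([1 + 2 * (m : ℂ), 1 + 2 * (n : ℂ), d + 1].map
      (poch · k)).prod / ([(m : ℂ) + (n : ℂ) + 5/2, d].map (poch · k)).prod) *
      (1 / 2) ^ k / (k ! : ℂ)) (gaussSeriesSum m n + 1 / d * gaussSeriesSumWeighted m n) := by
    refine h.congr_terms fun k => ?_
    have hdk := poch_ne_zero (natCast_shift_ne_zero hd) k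
    have hck := poch_ne_zero (lower_param_add_ne_zero m n) k
    have hk : (k ! : ℂ) ≠ 0 := by exact_mod_cast k.factorial_ne_zero
    simp only [List.map_cons, List.map_nil, List.prod_cons, List.prod_nil, mul_one, hterm,
      gaussTerm]
    field_simp
  rw [hyp, hsum.tsum_eq, gaussSeriesSum, gaussSeriesSumWeighted]
  ring
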